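/- There exist an alternating P-bilinear map Ψ₁ : F₁ × F₁ → F₂ (Ψ₁(x,x) = 0 for all x), P-bilinear maps Ψ₂ : F₁ × F₂ → F₃ and ψ₃ : F₁ × F₃ → F₄, and a quadratic map ψ₄ : F₂ → F₄ with polar form ψ̄₄, such that for all xᵢ, yᵢ, zᵢ ∈ Fᵢ: (1) d₂(Ψ₁(x₁,y₁)) = d₁(x₁)·y₁ − d₁(y₁)·x₁; (2) d₃(Ψ₂(x₁,x₂)) = d₁(x₁)·x₂ − Ψ₁(x₁, d₂x₂); (3) d₄(ψ₃(x₁,x₃)) = d₁(x₁)·x₃ − Ψ₂(x₁, d₃x₃); (4) d₄(ψ̄₄(x₂,y₂)) = Ψ₂(d₂x₂, y₂) + Ψ₂(d₂y₂, x₂); (5) d₄(ψ₄(x₂)) = Ψ₂(d₂x₂, x₂); (6) ψ₃(x₁, d₄x₄) = d₁(x₁)·x₄; (7) ψ̄₄(x₂, d₃x₃) = −ψ₃(d₂x₂, x₃); (8) Ψ₂(z₁, Ψ₁(x₁,y₁)) = Ψ₂(x₁, Ψ₁(y₁,z₁)); (9) ψ̄₄(Ψ₁(y₁,x₁), x₂)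 = ψ₃(y₁, Ψ₂(x₁,x₂)); and (10) the induced P-linear maps F₁ → Hom_P(F₃,F₄), x₁ ↦ ψ₃(x₁,−); F₂ → Hom_P(F₂,F₄), x₂ ↦ ψ̄₄(x₂,−); and F₃ → Hom_P(F₁,F₄), x₃ ↦ ψ₃(−,x₃), are isomorphisms. (That is, F carries the structure of a DG-algebra with divided powers which exhibits Poincaré duality.) -/

import Mathlib

open QuadraticMap LinearMap Submodule Function

section Lifting

variable {P M N A C : Type*} [CommRing P]
  [AddCommGroup M] [Module P M] [AddCommGroup N] [Module P N]
  [AddCommGroup A] [Module P A] [AddCommGroup C] [Module P C]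

/-- A linear map from a projective module lifts along any map whose range contains its values. -/
theorem LinearMap.exists_lift_of_mem_range [Module.Projective P M]
    (g : A →ₗ[P] C) (f : M →ₗ[P] C) (hf : ∀ x, f x ∈ LinearMap.range g) :
    ∃ h : M →ₗ[P] A, ∀ x, g (h x) = f x := by
  obtain ⟨h, hh⟩ := Module.projective_lifting_property g.rangeRestrict
    (f.codRestrict (LinearMap.range g) hf) g.surjective_rangeRestrict
  exact ⟨h, fun x => congrArg Subtype.val (LinearMap.congr_fun hh x)⟩

/-- The analogue of `LinearMap.exists_lift_of_mem_range` for bilinear maps. -/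
theorem LinearMap.exists_lift₂_of_mem_range [Module.Projective P M] [Module.Projective P N]
    (g : A →ₗ[P] C) (f : M →ₗ[P] N →ₗ[P] C) (hf : ∀ x y, f x y ∈ LinearMap.range g) :
    ∃ h : M →ₗ[P] N →ₗ[P] A, ∀ x y, g (h x y) = f x y := by
  obtain ⟨h, hh⟩ := g.exists_lift_of_mem_range (TensorProduct.lift f) fun t => by
    induction t with
    | zero => simp
    | tmul x y => simpa using hf x y
    | add s t hs ht => rw [map_add]; exact add_mem hs ht
  exact ⟨TensorProduct.curry h, fun x y => by simp [hh]⟩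

/-- The analogue of `LinearMap.exists_lift_of_mem_range` for alternating maps on a free module. -/
theorem AlternatingMap.exists_lift_of_mem_range [Module.Free P M] {n : ℕ}
    (g : A →ₗ[P] C) (f : M [⋀^Fin n]→ₗ[P] C) (hf : ∀ v, f v ∈ LinearMap.range g) :
    ∃ h : M [⋀^Fin n]→ₗ[P] A, ∀ v, g (h v) = f v := by
  obtain ⟨h, hh⟩ := g.exists_lift_of_mem_range
    ((LinearMap.range g).subtype.comp
      (exteriorPower.alternatingMapLinearEquiv (f.codRestrict (LinearMap.range g) hf)))
    fun t => Subtype.property _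
  exact ⟨h.compAlternatingMap (exteriorPower.ιMulti P n), fun v => by simp [hh]⟩

/-- The bilinear map underlying an alternating map in two variables. -/
def AlternatingMap.toBilinear : (M [⋀^Fin 2]→ₗ[P] N) →ₗ[P] M →ₗ[P] M →ₗ[P] N :=
  LinearMap.mk₂ P
    (fun f x => (AlternatingMap.ofSubsingleton P M N (0 : Fin 1)).symm (f.curryLeft x))
    (fun f g x => by ext; simp)
    (fun c f x => by ext; simp)
    (fun f x y => by ext; simp)
    (fun c f x => by ext; simp)

@[simp]
theorem AlternatingMap.toBilinear_apply (f : M [⋀^Fin 2]→ₗ[P] N) (x y : M) :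
    AlternatingMap.toBilinear f x y = f ![x, y] :=
  congrArg f (funext fun i => by fin_cases i <;> rfl)

end Lifting

section SelfDual

variable {P F1 F2 F3 F4 : Type*} [CommRing P]
  [AddCommGroup F1] [Module P F1] [AddCommGroup F2] [Module P F2]
  [AddCommGroup F3] [Module P F3] [AddCommGroup F4] [Module P F4]

/-- The multiplication `F₁ × F₁ → F₂` on a resolution, as an alternating map. -/
theorem exists_alternating_mul [Module.Free P F1]
    (d1 : F1 →ₗ[P] P) (d2 : F2 →ₗ[P] F1) (hex1 : LinearMap.range d2 = LinearMap.ker d1) :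
    ∃ m : F1 [⋀^Fin 2]→ₗ[P] F2, ∀ x y, d2 (m ![x, y]) = d1 x • y - d1 y • x := by
  let k : F1 [⋀^Fin 2]→ₗ[P] F1 := AlternatingMap.alternatizeUncurryFin
    (d1.smulRight (AlternatingMap.ofSubsingleton P F1 F1 (0 : Fin 1) LinearMap.id))
  have hk (v : Fin 2 → F1) : k v = d1 (v 0) • v 1 - d1 (v 1) • v 0 := by
    simp [k, AlternatingMap.alternatizeUncurryFin_apply, Fin.sum_univ_succ, Fin.removeNth,
      sub_eq_add_neg]
  obtain ⟨m, hm⟩ := AlternatingMap.exists_lift_of_mem_range d2 k fun v => by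
    rw [hex1, LinearMap.mem_ker, hk]
    simp [mul_comm]
  exact ⟨m, fun x y => by simp [hm, hk]⟩

/-- An alternating triple product `F₁ × F₁ × F₁ → F₃` lifting the Koszul-type cycle of an
alternating multiplication `F₁ × F₁ → F₂`. -/
theorem exists_alternating_triple_mul [Module.Free P F1]
    (d1 : F1 →ₗ[P] P) (d2 : F2 →ₗ[P] F1) (d3 : F3 →ₗ[P] F2)
    (hex2 : LinearMap.range d3 = LinearMap.ker d2)
    (m : F1 [⋀^Fin 2]→ₗ[P] F2) (hm : ∀ x y, d2 (m ![x, y]) = d1 x • y - d1 y • x) :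
    ∃ a : F1 →ₗ[P] F1 →ₗ[P] F1 →ₗ[P] F3,
      (∀ x y z, d3 (a x y z) = d1 x • m ![y, z] - d1 y • m ![x, z] + d1 z • m ![x, y]) ∧
      (∀ x y, a x x y = 0) ∧  (∀ x y, a x y x = 0) := by
  let k : F1 [⋀^Fin 3]→ₗ[P] F2 := AlternatingMap.alternatizeUncurryFin (d1.smulRight m)
  have hk (x y z : F1) : k ![x, y, z] =
      d1 x • m ![y, z] - d1 y • m ![x, z] + d1 z • m ![x, y] := by
    have h0 : Fin.removeNth 0 ![x, y, z] = ![y, z] := by ext i; fin_cases i <;> rfl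
    have h1 : Fin.removeNth 1 ![x, y, z] = ![x, z] := by ext i; fin_cases i <;> rfl
    have h2 : Fin.removeNth 2 ![x, y, z] = ![x, y] := by ext i; fin_cases i <;> rfl
    simp [k, AlternatingMap.alternatizeUncurryFin_apply, Fin.sum_univ_three, h0, h1, h2,
      sub_eq_add_neg]
  obtain ⟨a, ha⟩ := AlternatingMap.exists_lift_of_mem_range d3 k fun v => by
    have hv : v = ![v 0, v 1, v 2] := by ext i; fin_cases i <;> rfl
    rw [hex2, LinearMap.mem_ker, hv, hk]
    simp only [map_add, map_sub, map_smul, hm]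
    module
  refine ⟨AlternatingMap.toBilinear.comp a.curryLeft, fun x y z => ?_, fun x y => ?_,
    fun x y => ?_⟩
  · simpa [hk] using ha ![x, y, z]
  · simpa using a.map_eq_zero_of_eq ![x, x, y] (i := 0) (j := 1) rfl (by decide)
  · simpa using a.map_eq_zero_of_eq ![x, y, x] (i := 0) (j := 2) rfl (by decide)

/-- If `x ↦ b x x` takes values in the range of an injective map `d`, then it lifts along `d` to
a quadratic map. -/
theorem QuadraticMap.exists_lift_of_mem_range [Module.Projective P F2]
    (d : F4 →ₗ[P] F3) (hd : Function.Injective d) (b : F2 →ₗ[P] F2 →ₗ[P] F3)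
    (hb : ∀ x, b x x ∈ LinearMap.range d) :
    ∃ q : QuadraticMap P F2 F4, (∀ x, d (q x) = b x x) ∧
      ∀ x y, d (polar q x y) = b x y + b y x := by
  choose f hf using hb
  obtain ⟨c, hc⟩ := d.exists_lift₂_of_mem_range (b + b.flip) fun x y =>
    ⟨f (x + y) - f x - f y, by
      simp only [map_sub, hf, map_add, LinearMap.add_apply, LinearMap.flip_apply]
      abel⟩
  refine ⟨⟨f, fun r x => hd (by simp [hf, mul_smul]), c, fun x y => hd ?_⟩, hf, fun x y => ?_⟩
  · simp only [map_add, hf, hc, LinearMap.add_apply, LinearMap.flip_apply]; abel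
  · change d (f (x + y) - f x - f y) = _
    simp only [map_sub, hf, map_add, LinearMap.add_apply]; abel

/-- Over a module isomorphic to the ground ring, a pairing with bijective left adjoint and
reflexive right argument has bijective right adjoint. -/
theorem LinearMap.bijective_flip_of_bijective [Module.IsReflexive P F3]
    (ρ : F4 ≃ₗ[P] P) (b : F1 →ₗ[P] F3 →ₗ[P] F4) (hb : Function.Bijective b) :
    Function.Bijective b.flip := by
  have h := LinearMap.IsPerfPair.of_bijective (b.compr₂ ρ.toLinearMap)
    ((ρ.congrRight (M := F3)).bijective.comp hb)
  exact ((ρ.congrRight (M := F1)).bijective.of_comp_iff' _).1 h.bijective_right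

/-- The five lemma for the map of complexes from an exact complex to its exact dual given by a
pairing of `F₁` with `F₃` and a pairing of `F₂` with itself. -/
theorem bijective_of_duality
    (d1 : F1 →ₗ[P] P) (d2 : F2 →ₗ[P] F1) (d3 : F3 →ₗ[P] F2) (d4 : F4 →ₗ[P] F3)
    (hd43 : ∀ x4, d3 (d4 x4) = 0)
    (hex2 : LinearMap.range d3 = LinearMap.ker d2)
    (hex1 : LinearMap.range d2 = LinearMap.ker d1)
    (hfaith : ∀ p : P, (∀ y : F4, p • y = 0) → p = 0)
    (hdual2 : ∀ f : F2 →ₗ[P] F4, (∀ x, f (d3 x) = 0) → ∃ g : F1 →ₗ[P] F4, ∀ x, f x = g (d2 x))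
    (hdual1 : ∀ f : F1 →ₗ[P] F4, (∀ x, f (d2 x) = 0) → ∃ y : F4, ∀ x, f x = d1 x • y)
    (b : F1 →ₗ[P] F3 →ₗ[P] F4) (hb : Function.Bijective b) (hb' : Function.Bijective b.flip)
    (hbd : ∀ x1 x4, b x1 (d4 x4) = d1 x1 • x4)
    (c : F2 →ₗ[P] F2 →ₗ[P] F4) (hc : ∀ x y, c x y = c y x)
    (hcb : ∀ x2 x3, c x2 (d3 x3) = - b (d2 x2) x3) :
    Function.Bijective c := by
  constructor
  · refine (injective_iff_map_eq_zero c).2 fun x hx => ?_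
    have h2 : d2 x = 0 := hb.1 (by
      ext x3
      have := hcb x x3
      rw [hx] at this
      simpa using this.symm)
    obtain ⟨x3, rfl⟩ : x ∈ LinearMap.range d3 := hex2 ▸ h2
    obtain ⟨y, hy⟩ := hdual1 (b.flip x3) fun w => by
      have := hcb w x3
      rw [hc, hx] at this
      simpa using this.symm
    have : x3 = d4 y := hb'.1 (by ext w; simpa [hbd] using hy w)
    rw [this, hd43]
  · intro g
    obtain ⟨x1, hx1⟩ := hb.2 (g.comp d3)
    have h1 : d1 x1 = 0 := hfaith _ fun y => by
      rw [← hbd, hx1]; simp [hd43]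
    obtain ⟨x2, rfl⟩ : x1 ∈ LinearMap.range d2 := hex1 ▸ h1
    obtain ⟨f, hf⟩ := hdual2 (g + c x2) fun x3 => by
      simp [hcb, hx1]
    obtain ⟨x3, hx3⟩ := hb'.2 f
    refine ⟨-x2 - d3 x3, ?_⟩
    ext w
    have h3 := hf w
    have h4 := hcb w x3
    rw [← hx3, LinearMap.flip_apply] at h3
    rw [LinearMap.add_apply] at h3
    rw [map_sub, map_neg, LinearMap.sub_apply, LinearMap.neg_apply, hc (d3 x3), h4, ← h3]
    abel

/-- If `Ψ₁` is alternating with `Ψ₂(x, Ψ₁(x, y)) = 0`, then `Ψ₂(x, Ψ₁(y, z))` is invariant under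
cyclic permutations. -/
theorem cyclic_of_left_alternative (Ψ1 : F1 →ₗ[P] F1 →ₗ[P] F2) (Ψ2 : F1 →ₗ[P] F2 →ₗ[P] F3)
    (h1 : ∀ x, Ψ1 x x = 0) (h2 : ∀ x y, Ψ2 x (Ψ1 x y) = 0) (x y z : F1) :
    Ψ2 z (Ψ1 x y) = Ψ2 x (Ψ1 y z) := by
  have e1 := h2 (x + z) y
  have e2 := h1 (y + z)
  simp only [map_add, LinearMap.add_apply, h1, h2, zero_add, add_zero] at e1 e2
  rw [eq_neg_of_add_eq_zero_right e2, map_neg]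
  exact eq_neg_of_add_eq_zero_left e1

/-- Given a pairing `b` of `F₁` with `F₃` compatible with the differentials, the multiplication
`Ψ₂` can be chosen so that `b` is the induced multiplication `F₁ × F₃ → F₄`. -/
theorem exists_mul_of_pairing [Module.Free P F1] [Module.Projective P F2] [Module.Projective P F3]
    (d1 : F1 →ₗ[P] P) (d2 : F2 →ₗ[P] F1) (d3 : F3 →ₗ[P] F2) (d4 : F4 →ₗ[P] F3)
    (hd21 : ∀ x2, d1 (d2 x2) = 0) (hd32 : ∀ x3, d2 (d3 x3) = 0) (hd43 : ∀ x4, d3 (d4 x4) = 0)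
    (hinj4 : Function.Injective d4)
    (hex3 : LinearMap.range d4 = LinearMap.ker d3)
    (hex2 : LinearMap.range d3 = LinearMap.ker d2)
    (hdual3 : ∀ f : F3 →ₗ[P] F4, (∀ x, f (d4 x) = 0) → ∃ g : F2 →ₗ[P] F4, ∀ x, f x = g (d3 x))
    (b : F1 →ₗ[P] F3 →ₗ[P] F4) (hbd : ∀ x1 x4, b x1 (d4 x4) = d1 x1 • x4)
    (Ψ1 : F1 →ₗ[P] F1 →ₗ[P] F2) (hΨ1 : ∀ x y, d2 (Ψ1 x y) = d1 x • y - d1 y • x) :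
    ∃ Ψ2 : F1 →ₗ[P] F2 →ₗ[P] F3,
      (∀ x1 x2, d3 (Ψ2 x1 x2) = d1 x1 • x2 - Ψ1 x1 (d2 x2)) ∧
      (∀ x1 x3, d4 (b x1 x3) = d1 x1 • x3 - Ψ2 x1 (d3 x3)) := by
  obtain ⟨Ψ, hΨ⟩ := d3.exists_lift₂_of_mem_range
    (d1.smulRight LinearMap.id - Ψ1.compl₂ d2) fun x y => by
      rw [hex2, LinearMap.mem_ker]
      simp [hΨ1, hd21]
  obtain ⟨m, hm⟩ := d4.exists_lift₂_of_mem_range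
    (d1.smulRight LinearMap.id - Ψ.compl₂ d3) fun x y => by
      rw [hex3, LinearMap.mem_ker]
      simp [hΨ, hd32]
  simp only [LinearMap.sub_apply, LinearMap.smulRight_apply, LinearMap.smul_apply,
    LinearMap.id_apply, LinearMap.compl₂_apply] at hΨ hm
  obtain ⟨h, hh⟩ := LinearMap.exists_lift_of_mem_range (LinearMap.lcomp P F4 d3) (b - m)
    fun x => by
      obtain ⟨g, hg⟩ := hdual3 ((b - m) x) fun x4 => hinj4 (by
        simp [hm, hbd, hd43])
      exact ⟨g, by ext x3; simp [← hg]⟩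
  have hh' (x1 : F1) (x3 : F3) : b x1 x3 = m x1 x3 + h x1 (d3 x3) := by
    have := LinearMap.congr_fun (hh x1) x3
    simp only [LinearMap.lcomp_apply, LinearMap.sub_apply] at this
    rw [this]; abel
  refine ⟨Ψ - h.compr₂ d4, fun x1 x2 => ?_, fun x1 x3 => ?_⟩
  · simp [hΨ, hd43]
  · simp only [hh', map_add, hm, LinearMap.sub_apply, LinearMap.compr₂_apply]; abel

/-- Given a perfect pairing of `F₁` with `F₃`, the multiplications `Ψ₁` and `Ψ₂` can be chosen so
that moreover `Ψ₂(x, Ψ₁(x, y)) = 0`. -/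
theorem exists_left_alternative_mul
    [Module.Free P F1] [Module.Projective P F2] [Module.Projective P F3]
    (d1 : F1 →ₗ[P] P) (d2 : F2 →ₗ[P] F1) (d3 : F3 →ₗ[P] F2) (d4 : F4 →ₗ[P] F3)
    (hd21 : ∀ x2, d1 (d2 x2) = 0) (hd32 : ∀ x3, d2 (d3 x3) = 0) (hd43 : ∀ x4, d3 (d4 x4) = 0)
    (hinj4 : Function.Injective d4)
    (hex3 : LinearMap.range d4 = LinearMap.ker d3)
    (hex2 : LinearMap.range d3 = LinearMap.ker d2)
    (hex1 : LinearMap.range d2 = LinearMap.ker d1)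
    (hdual3 : ∀ f : F3 →ₗ[P] F4, (∀ x, f (d4 x) = 0) → ∃ g : F2 →ₗ[P] F4, ∀ x, f x = g (d3 x))
    (b : F1 →ₗ[P] F3 →ₗ[P] F4) (hb' : Function.Bijective b.flip)
    (hbd : ∀ x1 x4, b x1 (d4 x4) = d1 x1 • x4) :
    ∃ (Ψ1 : F1 →ₗ[P] F1 →ₗ[P] F2) (Ψ2 : F1 →ₗ[P] F2 →ₗ[P] F3),
      (∀ x, Ψ1 x x = 0) ∧
      (∀ x y, d2 (Ψ1 x y) = d1 x • y - d1 y • x) ∧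
      (∀ x1 x2, d3 (Ψ2 x1 x2) = d1 x1 • x2 - Ψ1 x1 (d2 x2)) ∧
      (∀ x1 x3, d4 (b x1 x3) = d1 x1 • x3 - Ψ2 x1 (d3 x3)) ∧
      (∀ x y, Ψ2 x (Ψ1 x y) = 0) := by
  obtain ⟨m, hm⟩ := exists_alternating_mul d1 d2 hex1
  obtain ⟨a, ha, ha1, ha2⟩ := exists_alternating_triple_mul d1 d2 d3 hex2 m hm
  have hm0 (x : F1) : m ![x, x] = 0 :=
    m.map_eq_zero_of_eq ![x, x] (i := 0) (j := 1) rfl (by decide)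
  have hm1 (x y : F1) : m ![x, y] = - m ![y, x] := by
    simpa using m.map_swap ![y, x] (i := 0) (j := 1) (by decide)
  simp only [← AlternatingMap.toBilinear_apply] at hm ha hm0 hm1
  generalize AlternatingMap.toBilinear m = μ at hm ha hm0 hm1
  obtain ⟨Ψ2, hΨ2, hbΨ⟩ := exists_mul_of_pairing d1 d2 d3 d4 hd21 hd32 hd43 hinj4 hex3 hex2
    hdual3 b hbd μ hm
  obtain ⟨β, hβ⟩ := LinearMap.exists_lift₂_of_mem_range (b.flip.compr₂ d4)
    (μ.compr₂ Ψ2.flip - a) fun z x => by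
      obtain ⟨l, hl⟩ := d4.exists_lift_of_mem_range ((μ.compr₂ Ψ2.flip - a) z x) fun y => by
        rw [hex3, LinearMap.mem_ker]
        simp only [LinearMap.sub_apply, LinearMap.compr₂_apply, LinearMap.flip_apply,
          map_sub, hΨ2, hm, ha, map_smul]
        rw [hm1 x y, hm1 z y]
        module
      obtain ⟨w, rfl⟩ := hb'.2 l
      exact ⟨w, by ext y; simpa using hl y⟩
  replace hβ (y z x : F1) : d4 (b y (β z x)) = Ψ2 y (μ z x) - a z x y := by
    simpa using LinearMap.congr_fun (hβ z x) y
  have hβ0 (x : F1) : β x x = 0 :=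
    hb'.1 (by ext y; exact hinj4 (by simp [hβ, hm0, ha1]))
  refine ⟨μ + β.compr₂ d3, Ψ2 - β.compl₂ d2, fun x => ?_,
    fun x y => ?_, fun x1 x2 => ?_, fun x1 x3 => ?_, fun x y => ?_⟩
  · simp [hβ0, hm0]
  · simp [hm, hd32]
  · simp only [LinearMap.sub_apply, LinearMap.add_apply, LinearMap.compr₂_apply,
      LinearMap.compl₂_apply, map_sub, hΨ2]
    abel
  · simp [hbΨ, hd32]
  · have h := hbΨ x (β x y)
    rw [hβ, ha2, sub_zero] at h
    simp [hm, hd32, hβ0, h]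

end SelfDual

theorem stmt_0
    (P : Type*) [CommRing P] [IsNoetherianRing P]
    (F1 F2 F3 F4 : Type*)
    [AddCommGroup F1] [Module P F1] [Module.Free P F1] [Module.Finite P F1]
    [AddCommGroup F2] [Module P F2] [Module.Free P F2] [Module.Finite P F2]
    [AddCommGroup F3] [Module P F3] [Module.Free P F3] [Module.Finite P F3]
    [AddCommGroup F4] [Module P F4] [Module.Free P F4] [Module.Finite P F4]
    (d1 : F1 →ₗ[P] P) (d2 : F2 →ₗ[P] F1) (d3 : F3 →ₗ[P] F2) (d4 : F4 →ₗ[P] F3)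
    (hd21 : ∀ x2, d1 (d2 x2) = 0) (hd32 : ∀ x3, d2 (d3 x3) = 0)
    (hd43 : ∀ x4, d3 (d4 x4) = 0)
    (hinj4 : Function.Injective d4)
    (hex3 : LinearMap.range d4 = LinearMap.ker d3)
    (hex2 : LinearMap.range d3 = LinearMap.ker d2)
    (hex1 : LinearMap.range d2 = LinearMap.ker d1)
    (hrank : Nonempty (F4 ≃ₗ[P] P))
    (φ0 : P ≃ₗ[P] (F4 →ₗ[P] F4)) (φ1 : F1 ≃ₗ[P] (F3 →ₗ[P] F4))
    (φ2 : F2 ≃ₗ[P] (F2 →ₗ[P] F4)) (φ3 : F3 ≃ₗ[P] (F1 →ₗ[P] F4))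
    (φ4 : F4 ≃ₗ[P] (P →ₗ[P] F4))
    (hφ1 : ∀ x1 y4, φ0 (d1 x1) y4 = φ1 x1 (d4 y4))
    (hφ2 : ∀ x2 y3, φ1 (d2 x2) y3 = φ2 x2 (d3 y3))
    (hφ3 : ∀ x3 y2, φ2 (d3 x3) y2 = φ3 x3 (d2 y2))
    (hφ4 : ∀ x4 y1, φ3 (d4 x4) y1 = φ4 x4 (d1 y1))
    : ∃ (Ψ1 : F1 →ₗ[P] F1 →ₗ[P] F2) (Ψ2 : F1 →ₗ[P] F2 →ₗ[P] F3)
        (ψ3 : F1 →ₗ[P] F3 →ₗ[P] F4) (ψ4 : QuadraticMap P F2 F4),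
      (∀ x1, Ψ1 x1 x1 = 0) ∧
      (∀ x1 y1, d2 (Ψ1 x1 y1) = d1 x1 • y1 - d1 y1 • x1) ∧
      (∀ x1 x2, d3 (Ψ2 x1 x2) = d1 x1 • x2 - Ψ1 x1 (d2 x2)) ∧
      (∀ x1 x3, d4 (ψ3 x1 x3) = d1 x1 • x3 - Ψ2 x1 (d3 x3)) ∧
      (∀ x2 y2, d4 (polar ψ4 x2 y2) = Ψ2 (d2 x2) y2 + Ψ2 (d2 y2) x2) ∧
      (∀ x2, d4 (ψ4 x2) = Ψ2 (d2 x2) x2) ∧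
      (∀ x1 x4, ψ3 x1 (d4 x4) = d1 x1 • x4) ∧
      (∀ x2 x3, polar ψ4 x2 (d3 x3) = - ψ3 (d2 x2) x3) ∧
      (∀ x1 y1 z1, Ψ2 z1 (Ψ1 x1 y1) = Ψ2 x1 (Ψ1 y1 z1)) ∧
      (∀ y1 x1 x2, polar ψ4 (Ψ1 y1 x1) x2 = ψ3 y1 (Ψ2 x1 x2)) ∧
      Function.Bijective ψ3 ∧
      Function.Bijective (polarBilin ψ4) ∧
      Function.Bijective ψ3.flip := by
  obtain ⟨ρ⟩ := hrank
  obtain ⟨p, hp⟩ := φ0.surjective LinearMap.id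
  have hφ0 (r : P) (y : F4) : φ0 r y = r • φ0 1 y := by
    rw [← LinearMap.smul_apply, ← map_smul, smul_eq_mul, mul_one]
  have hp1 (y : F4) : p • φ0 1 y = y := by rw [← hφ0, hp, LinearMap.id_apply]
  let u : F4 ≃ₗ[P] F4 := LinearEquiv.ofLinearMap (p • LinearMap.id) (φ0 1)
    (by ext y; simp [hp1]) (by ext y; simp [hp1])
  have hu (y : F4) : u y = p • y := rfl
  let b : F1 →ₗ[P] F3 →ₗ[P] F4 := φ1.toLinearMap.compr₂ u.toLinearMap
  have hbφ (x1 : F1) (x3 : F3) : b x1 x3 = p • φ1 x1 x3 := rfl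
  have hb : Function.Bijective b := (u.congrRight (M := F3)).bijective.comp φ1.bijective
  have hb' : Function.Bijective b.flip := LinearMap.bijective_flip_of_bijective ρ b hb
  have hbd (x1 : F1) (x4 : F4) : b x1 (d4 x4) = d1 x1 • x4 := by
    rw [hbφ, ← hφ1, hφ0, smul_comm, hp1]
  have hfaith (r : P) (hr : ∀ y : F4, r • y = 0) : r = 0 := by
    simpa using congrArg ρ (hr (ρ.symm 1))
  have hdual3 (f : F3 →ₗ[P] F4) (hf : ∀ x, f (d4 x) = 0) :
      ∃ g : F2 →ₗ[P] F4, ∀ x, f x = g (d3 x) := by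
    obtain ⟨x1, rfl⟩ := φ1.surjective f
    obtain ⟨x2, rfl⟩ : x1 ∈ LinearMap.range d2 := hex1 ▸ φ0.injective (by
      ext y; simpa [hφ1] using hf y)
    exact ⟨φ2 x2, hφ2 x2⟩
  have hdual2 (f : F2 →ₗ[P] F4) (hf : ∀ x, f (d3 x) = 0) :
      ∃ g : F1 →ₗ[P] F4, ∀ x, f x = g (d2 x) := by
    obtain ⟨x2, rfl⟩ := φ2.surjective f
    obtain ⟨x3, rfl⟩ : x2 ∈ LinearMap.range d3 := hex2 ▸ φ1.injective (by
      ext y; simpa [hφ2] using hf y)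
    exact ⟨φ3 x3, hφ3 x3⟩
  have hdual1 (f : F1 →ₗ[P] F4) (hf : ∀ x, f (d2 x) = 0) :
      ∃ y : F4, ∀ x, f x = d1 x • y := by
    obtain ⟨x3, rfl⟩ := φ3.surjective f
    obtain ⟨x4, rfl⟩ : x3 ∈ LinearMap.range d4 := hex3 ▸ φ2.injective (by
      ext y; simpa [hφ3] using hf y)
    exact ⟨φ4 x4 1, fun x => by
      rw [hφ4, ← map_smul, smul_eq_mul, mul_one]⟩
  obtain ⟨Ψ1, Ψ2, h0, h1, h2, h3, h8⟩ := exists_left_alternative_mul d1 d2 d3 d4 hd21 hd32 hd43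
    hinj4 hex3 hex2 hex1 hdual3 b hb' hbd
  have hcyc := cyclic_of_left_alternative Ψ1 Ψ2 h0 h8
  obtain ⟨ψ4, h5, h4⟩ := QuadraticMap.exists_lift_of_mem_range d4 hinj4 (Ψ2.comp d2) fun x => by
    rw [hex3, LinearMap.mem_ker]
    simp [h2, hd21, h0]
  simp only [LinearMap.comp_apply] at h4 h5
  have h7 (x2 : F2) (x3 : F3) : polar ψ4 x2 (d3 x3) = - b (d2 x2) x3 := hinj4 (by
    simp [h4, h3, hd21, hd32])
  refine ⟨Ψ1, Ψ2, b, ψ4, h0, h1, h2, h3, h4, h5, hbd, h7, hcyc, fun y1 x1 x2 => hinj4 ?_, hb,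
    bijective_of_duality d1 d2 d3 d4 hd43 hex2 hex1 hfaith hdual2 hdual1 b hb hb' hbd
      (polarBilin ψ4) (fun x y => QuadraticMap.polar_comm ψ4 x y) h7, hb'⟩
  rw [h4, h3, h1, h2, hcyc y1 x1 (d2 x2)]
  simp only [map_sub, map_smul, LinearMap.sub_apply, LinearMap.smul_apply]
  abel
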